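/- arXiv:2109.10002 — 2 statements merged into one kernel-verified Lean document; each statement's English description precedes it below -/
import Mathlib

section
/- Perpetual free-choice systems are safe: if (N,μ₀) is a perpetual free-choice system, then every reachable marking μ of (N,μ₀) satisfies μ(p) ≤ 1 for every place p of N. -/
open Classical

/-- A (finite, bipartite) Petri *net*: disjoint finite sets of places and
transitions, and an edge relation running only between places and transitions. -/
structure Net (α : Type*) where
  places : Finset α
  transitions : Finset α
  F : α → α → Prop
  disj : Disjoint places transitions
  edges : ∀ x y, F x y →
    (x ∈ places ∧ y ∈ transitions) ∨ (x ∈ transitions ∧ y ∈ places)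

namespace Net

variable {α : Type*} [DecidableEq α]

/-- The nodes of a net. -/
def nodes (N : Net α) : Finset α := N.places ∪ N.transitions

/-- Pre-set of a node. -/
def pre (N : Net α) (x : α) : Set α := {y | N.F y x}

/-- Post-set of a node. -/
def post (N : Net α) (x : α) : Set α := {y | N.F x y}

/-- A transition `t` is enabled at a marking `μ` if every pre-place is marked. -/
def Enabled (N : Net α) (μ : α → ℕ) (t : α) : Prop :=
  t ∈ N.transitions ∧ ∀ p, N.F p t → 1 ≤ μ p

/-- Firing a transition: remove one token from each pre-place,
add one token at each post-place. -/
noncomputable def fire (N : Net α) (t : α) (μ : α → ℕ) : α → ℕ :=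
  fun p => μ p - (if N.F p t then 1 else 0) + (if N.F t p then 1 else 0)

/-- `FireSeq N μ σ ν`: the occurrence sequence `σ` is enabled at `μ` and
firing it successively leads from `μ` to `ν`. -/
inductive FireSeq (N : Net α) : (α → ℕ) → List α → (α → ℕ) → Prop
  | nil (μ : α → ℕ) : FireSeq N μ [] μ
  | cons {μ ν : α → ℕ} {t : α} {σ : List α} :
      N.Enabled μ t → FireSeq N (N.fire t μ) σ ν → FireSeq N μ (t :: σ) ν

/-- Reachability of markings. -/
def Reach (N : Net α) (μ ν : α → ℕ) : Prop := ∃ σ : List α, N.FireSeq μ σ ν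

/-- The set of transitions enabled at `μ`. -/
def en (N : Net α) (μ : α → ℕ) : Set α := {t | N.Enabled μ t}

/-- Equality of markings (as maps on the places of the net). -/
def MarkingEq (N : Net α) (μ ν : α → ℕ) : Prop := ∀ p ∈ N.places, μ p = ν p

/-- Liveness of a Petri net `(N, μ₀)`. -/
def Live (N : Net α) (μ₀ : α → ℕ) : Prop :=
  ∀ t ∈ N.transitions, ∀ μ, N.Reach μ₀ μ → ∃ ν, N.Reach μ ν ∧ N.Enabled ν t

/-- Boundedness of a Petri net `(N, μ₀)`. -/
def Bounded (N : Net α) (μ₀ : α → ℕ) : Prop :=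
  ∃ K : ℕ, ∀ μ, N.Reach μ₀ μ → ∀ p ∈ N.places, μ p ≤ K

/-- A net is well-formed if it carries a live and bounded marking. -/
def WellFormed (N : Net α) : Prop := ∃ μ₀ : α → ℕ, N.Live μ₀ ∧ N.Bounded μ₀

/-- Free-choice net: `(p,t) ∈ F` implies `•t × p• ⊆ F`. -/
def FreeChoice (N : Net α) : Prop :=
  ∀ p ∈ N.places, ∀ t, N.F p t → ∀ p', N.F p' t → ∀ t', N.F p t' → N.F p' t'

/-- T-net: every place has exactly one pre-transition and one post-transition. -/
def IsTNet (N : Net α) : Prop :=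
  ∀ p ∈ N.places, (∃! t, N.F t p) ∧ (∃! t, N.F p t)

/-- A set of nodes is cluster-closed if with each place it contains the
post-set of the place and with each transition the pre-set of the transition. -/
def ClusterClosed (N : Net α) (S : Set α) : Prop :=
  (∀ p ∈ S, p ∈ N.places → ∀ t, N.F p t → t ∈ S) ∧
  (∀ t ∈ S, t ∈ N.transitions → ∀ p, N.F p t → p ∈ S)

/-- The cluster of a node: the smallest cluster-closed set of nodes containing it. -/
def clusterOf (N : Net α) (x : α) : Set α :=
  ⋂₀ {S : Set α | x ∈ S ∧ N.ClusterClosed S}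

/-- `cl` is a cluster of `N` if it is the cluster of some node. -/
def IsCluster (N : Net α) (cl : Set α) : Prop :=
  ∃ x ∈ N.nodes, cl = N.clusterOf x

/-- The marking `μ_cl` marking exactly the places of the cluster `cl`, once. -/
noncomputable def clusterMarking (N : Net α) (cl : Set α) : α → ℕ :=
  fun p => if p ∈ cl ∧ p ∈ N.places then 1 else 0

/-- `μh` is a home marking of `(N, μ₀)`: reachable from every reachable marking. -/
def IsHomeMarking (N : Net α) (μ₀ μh : α → ℕ) : Prop :=
  ∀ μ, N.Reach μ₀ μ → ∃ ν, N.Reach μ ν ∧ N.MarkingEq ν μh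

/-- `(N, μ₀)` is perpetual with regeneration cluster `cl`: live, bounded, and
`μ_cl` is a home marking for the cluster `cl`. -/
def Perpetual (N : Net α) (μ₀ : α → ℕ) (cl : Set α) : Prop :=
  N.Live μ₀ ∧ N.Bounded μ₀ ∧ N.IsCluster cl ∧
    N.IsHomeMarking μ₀ (N.clusterMarking cl)

/-- Lucency: enabling-equivalent reachable markings are equal. -/
def Lucent (N : Net α) (μ₀ : α → ℕ) : Prop :=
  ∀ μ₁ μ₂, N.Reach μ₀ μ₁ → N.Reach μ₀ μ₂ → N.en μ₁ = N.en μ₂ → N.MarkingEq μ₁ μ₂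

/-- A path of the net: a nonempty sequence of nodes along edges. -/
def IsPath (N : Net α) (δ : List α) : Prop :=
  δ ≠ [] ∧ (∀ x ∈ δ, x ∈ N.nodes) ∧ δ.Chain' N.F

/-- A circuit: a path whose last node is connected back to its first node. -/
def IsCircuit (N : Net α) (δ : List α) : Prop :=
  N.IsPath δ ∧ ∃ h : δ ≠ [], N.F (δ.getLast h) (δ.head h)

/-- Token count of a set of nodes: total number of tokens on its places. -/
def tokenCount (N : Net α) (μ : α → ℕ) (X : Finset α) : ℕ :=
  ∑ p ∈ X ∩ N.places, μ p

/-- The set `S` of nodes is strongly connected (in the induced subnet). -/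
def StronglyConnectedOn (N : Net α) (S : Finset α) : Prop :=
  ∀ x ∈ S, ∀ y ∈ S,
    Relation.ReflTransGen (fun a b => a ∈ S ∧ b ∈ S ∧ N.F a b) x y

/-- The set `S` of nodes is weakly connected (in the induced subnet). -/
def WeaklyConnectedOn (N : Net α) (S : Finset α) : Prop :=
  ∀ x ∈ S, ∀ y ∈ S,
    Relation.ReflTransGen (fun a b => a ∈ S ∧ b ∈ S ∧ (N.F a b ∨ N.F b a)) x y

/-- The (full) subnet spanned by `S` is transition-bordered: every place of `S`
has all its neighbours inside `S`. -/
def TransitionBordered (N : Net α) (S : Finset α) : Prop :=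
  ∀ p ∈ S, p ∈ N.places → ∀ y, (N.F y p ∨ N.F p y) → y ∈ S

/-- The full subnet spanned by `S` is a T-net: each place of `S` has exactly one
pre-transition and one post-transition inside `S`. -/
def TNetOn (N : Net α) (S : Finset α) : Prop :=
  ∀ p ∈ S, p ∈ N.places →
    (∃! t, t ∈ S ∧ N.F t p) ∧ (∃! t, t ∈ S ∧ N.F p t)

/-- `S` spans a CP-subnet of `N`: nonempty, weakly connected, transition-bordered,
a T-net, and the complement contains a transition and is strongly connected. -/
def IsCPSubnet (N : Net α) (S : Finset α) : Prop :=
  S.Nonempty ∧ S ⊆ N.nodes ∧ N.WeaklyConnectedOn S ∧ N.TransitionBordered S ∧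
  N.TNetOn S ∧ ((N.nodes \ S) ∩ N.transitions).Nonempty ∧
  N.StronglyConnectedOn (N.nodes \ S)

/-- The full subnet of `N` spanned by the node set `S`, as a net. -/
def restrict (N : Net α) (S : Finset α) : Net α where
  places := N.places ∩ S
  transitions := N.transitions ∩ S
  F := fun x y => x ∈ S ∧ y ∈ S ∧ N.F x y
  disj := N.disj.mono Finset.inter_subset_left Finset.inter_subset_left
  edges := by
    rintro x y ⟨hx, hy, hF⟩
    rcases N.edges x y hF with ⟨h1, h2⟩ | ⟨h1, h2⟩
    · exact Or.inl ⟨Finset.mem_inter.mpr ⟨h1, hx⟩, Finset.mem_inter.mpr ⟨h2, hy⟩⟩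
    · exact Or.inr ⟨Finset.mem_inter.mpr ⟨h1, hx⟩, Finset.mem_inter.mpr ⟨h2, hy⟩⟩

/-- A CP-exhaustion: a family of pairwise disjoint CP-subnets whose complement
is a strongly connected T-net. -/
def IsCPExhaustion (N : Net α) {n : ℕ}
    (Nhat : Fin n → Finset α) : Prop :=
  (∀ i, N.IsCPSubnet (Nhat i)) ∧
  (∀ i j, i ≠ j → Disjoint (Nhat i) (Nhat j)) ∧
  N.StronglyConnectedOn (N.nodes \ Finset.univ.biUnion Nhat) ∧
  N.TNetOn (N.nodes \ Finset.univ.biUnion Nhat)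

/-- `t` is a way-in transition of the subnet spanned by `S`: a transition of `S`
with a pre-place outside `S`. -/
def IsWayIn (N : Net α) (S : Finset α) (t : α) : Prop :=
  t ∈ S ∧ t ∈ N.transitions ∧ ∃ p ∈ N.places, p ∉ S ∧ N.F p t

/-- A shutdown sequence for the subnet spanned by `S` (with way-in transition
`tin`) at a marking `μ`: an occurrence sequence enabled at `μ` using only
transitions of `S` other than `tin`, after which no transition of `S` other
than (possibly) `tin` is enabled. -/
def IsShutdownSeq (N : Net α) (S : Finset α) (tin : α)
    (μ : α → ℕ) (σ : List α) (μsd : α → ℕ) : Prop :=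
  N.FireSeq μ σ μsd ∧
  (∀ t ∈ σ, t ∈ S ∧ t ∈ N.transitions ∧ t ≠ tin) ∧
  (∀ t ∈ S, t ∈ N.transitions → t ≠ tin → ¬ N.Enabled μsd t)

/-- `C` spans a P-component of `N`: nonempty, strongly connected, inside `C`
every transition has exactly one pre-place and one post-place, and every place
of `C` has all its neighbours inside `C`. -/
def IsPComponent (N : Net α) (C : Finset α) : Prop :=
  C.Nonempty ∧ C ⊆ N.nodes ∧ N.StronglyConnectedOn C ∧
  (∀ t ∈ C, t ∈ N.transitions →
    (∃! p, p ∈ C ∧ N.F p t) ∧ (∃! p, p ∈ C ∧ N.F t p)) ∧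
  (∀ p ∈ C, p ∈ N.places → ∀ y, (N.F y p ∨ N.F p y) → y ∈ C)

end Net

namespace Net

section Firing

variable {α : Type*} {N : Net α}

theorem F_place_transition {p t : α} (hp : p ∈ N.places) (h : N.F p t) : t ∈ N.transitions := by
  rcases N.edges p t h with h' | h'
  · exact h'.2
  · exact absurd h'.1 (Finset.disjoint_left.mp N.disj hp)

theorem F_transition_place {t p : α} (ht : t ∈ N.transitions) (h : N.F t p) : p ∈ N.places := by
  rcases N.edges t p h with h' | h'
  · exact absurd ht (Finset.disjoint_left.mp N.disj h'.1)
  · exact h'.2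

theorem place_of_F_transition {p t : α} (ht : t ∈ N.transitions) (h : N.F p t) :
    p ∈ N.places := by
  rcases N.edges p t h with hl | hr
  · exact hl.1
  · exact absurd ht (Finset.disjoint_left.mp N.disj hr.2)

/-- The change of the token count on `p` caused by firing `t`. -/
noncomputable def effect (N : Net α) (t : α) : α → ℤ :=
  fun p => (if N.F t p then 1 else 0) - (if N.F p t then 1 else 0)

/-- A marking seen as an integer vector. -/
def toInt (μ : α → ℕ) : α → ℤ := fun p => (μ p : ℤ)

theorem toInt_fire {μ : α → ℕ} {t : α} (h : N.Enabled μ t) :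
    toInt (N.fire t μ) = toInt μ + N.effect t := by
  funext p
  have := h.2 p
  simp only [toInt, fire, effect, Pi.add_apply]
  by_cases h1 : N.F p t
  · have := this h1
    split_ifs <;> simp <;> omega
  · split_ifs <;> simp

theorem fire_add {μ : α → ℕ} {t : α} (h : N.Enabled μ t) (p : α) :
    N.fire t μ p + (if N.F p t then 1 else 0) = μ p + (if N.F t p then 1 else 0) := by
  have := h.2 p
  simp only [fire]
  by_cases h1 : N.F p t
  · have := this h1
    simp only [h1, if_true]
    omega
  · simp [h1]

theorem FireSeq.append {μ ν ξ : α → ℕ} {σ τ : List α} (h : N.FireSeq μ σ ν)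
    (h' : N.FireSeq ν τ ξ) : N.FireSeq μ (σ ++ τ) ξ := by
  induction h with
  | nil => exact h'
  | cons he _ ih => exact FireSeq.cons he (ih h')

theorem Reach.refl (μ : α → ℕ) : N.Reach μ μ := ⟨[], FireSeq.nil μ⟩

theorem Reach.trans {μ ν ξ : α → ℕ} (h : N.Reach μ ν) (h' : N.Reach ν ξ) : N.Reach μ ξ := by
  obtain ⟨σ, hσ⟩ := h
  obtain ⟨τ, hτ⟩ := h'
  exact ⟨σ ++ τ, hσ.append hτ⟩

theorem Reach.fire {μ : α → ℕ} {t : α} (h : N.Enabled μ t) : N.Reach μ (N.fire t μ) :=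
  ⟨[t], FireSeq.cons h (FireSeq.nil _)⟩

theorem FireSeq.mem_transitions {μ ν : α → ℕ} {σ : List α} (h : N.FireSeq μ σ ν) :
    ∀ t ∈ σ, t ∈ N.transitions := by
  induction h with
  | nil => simp
  | cons he _ ih =>
    intro t ht
    rcases List.mem_cons.mp ht with rfl | ht
    · exact he.1
    · exact ih t ht

/-- Token balance on a place along an occurrence sequence. -/
theorem FireSeq.balance {μ ν : α → ℕ} {σ : List α} (h : N.FireSeq μ σ ν) (p : α) :
    μ p + σ.countP (fun t => decide (N.F t p)) = ν p + σ.countP (fun t => decide (N.F p t)) := by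
  induction h with
  | nil => simp
  | cons he _ ih =>
    have := fire_add he p
    simp only [List.countP_cons, decide_eq_true_eq]
    omega

theorem FireSeq.toInt_sub_mem {V : Submodule ℤ (α → ℤ)} {μ ν : α → ℕ} {σ : List α}
    (h : N.FireSeq μ σ ν) (hσ : ∀ t ∈ σ, N.effect t ∈ V) : toInt ν - toInt μ ∈ V := by
  induction h with
  | nil => simp
  | @cons μ ν t σ he _ ih =>
    have h1 := ih fun u hu => hσ u (List.mem_cons_of_mem _ hu)
    have h2 := V.add_mem h1 (hσ t List.mem_cons_self)
    rw [toInt_fire he] at h2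
    convert h2 using 1
    abel

theorem FireSeq.eq_of_notMem_places {μ ν : α → ℕ} {σ : List α} (h : N.FireSeq μ σ ν) {p : α}
    (hp : p ∉ N.places) : ν p = μ p := by
  induction h with
  | nil => rfl
  | @cons μ ν t σ he _ ih =>
    have h1 : ¬ N.F p t := fun h => hp (place_of_F_transition he.1 h)
    have h2 : ¬ N.F t p := fun h => hp (F_transition_place he.1 h)
    rw [ih]
    simp [Net.fire, h1, h2]

/-- Occurrence sequences remain enabled when tokens are added. -/
theorem FireSeq.add {μ ν : α → ℕ} {σ : List α} (h : N.FireSeq μ σ ν) (δ : α → ℕ) :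
    N.FireSeq (μ + δ) σ (ν + δ) := by
  induction h with
  | nil => exact FireSeq.nil _
  | @cons μ ν t σ he _ ih =>
    have he' : N.Enabled (μ + δ) t := ⟨he.1, fun p hp => le_add_right (he.2 p hp)⟩
    refine FireSeq.cons he' ?_
    convert ih using 1
    funext p
    have h1 := fire_add he p
    have h2 := fire_add he' p
    simp only [Pi.add_apply] at h2 ⊢
    omega

/-- In a bounded system no reachable marking leads to a strictly larger one. -/
theorem Bounded.eq_of_reach_of_le {μ₀ μ ν : α → ℕ} (hb : N.Bounded μ₀) (hμ : N.Reach μ₀ μ)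
    (h : N.Reach μ ν) (hle : μ ≤ ν) : ν = μ := by
  obtain ⟨K, hK⟩ := hb
  obtain ⟨σ, hσ⟩ := h
  obtain ⟨δ, rfl⟩ : ∃ δ, ν = μ + δ := ⟨ν - μ, (add_tsub_cancel_of_le hle).symm⟩
  have hn : ∀ n : ℕ, N.Reach μ (μ + n • δ) := by
    intro n
    induction n with
    | zero => simpa using Reach.refl μ
    | succ n ih =>
      refine ih.trans ⟨σ, ?_⟩
      convert hσ.add (n • δ) using 1
      rw [succ_nsmul]
      abel
  funext p
  by_cases hp : p ∈ N.places
  · by_contra hne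
    have h1 := hK _ (hμ.trans (hn (K + 1))) p hp
    have h2 : 1 ≤ δ p := by
      simp only [Pi.add_apply] at hne
      omega
    simp only [Pi.add_apply, Pi.smul_apply, smul_eq_mul] at h1
    nlinarith
  · exact hσ.eq_of_notMem_places hp

theorem Bounded.post_eq_empty_of_pre_eq_empty {μ₀ μ : α → ℕ} (hb : N.Bounded μ₀)
    (hμ : N.Reach μ₀ μ) {t : α} (ht : t ∈ N.transitions) (hpre : ∀ p, ¬ N.F p t) (q : α) :
    ¬ N.F t q := by
  intro hq
  have he : N.Enabled μ t := ⟨ht, fun p hp => absurd hp (hpre p)⟩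
  have := hb.eq_of_reach_of_le hμ (Reach.fire he) fun p => by simp [fire, hpre p]
  have := congrFun this q
  simp [fire, hpre q, hq] at this

end Firing

section Clusters

variable {α : Type*} {N : Net α} {cl : Set α}

theorem IsCluster.mem_of_place_edge [DecidableEq α] (h : N.IsCluster cl) {p t : α} (hp : p ∈ cl)
    (hpp : p ∈ N.places) (hF : N.F p t) : t ∈ cl := by
  obtain ⟨x, -, rfl⟩ := h
  intro S hS
  exact hS.2.1 p (hp S hS) hpp t hF

theorem IsCluster.mem_of_edge_transition [DecidableEq α] (h : N.IsCluster cl) {p t : α}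
    (ht : t ∈ cl) (htt : t ∈ N.transitions) (hF : N.F p t) : p ∈ cl := by
  obtain ⟨x, -, rfl⟩ := h
  intro S hS
  exact hS.2.2 t (ht S hS) htt p hF

theorem IsCluster.mem_of_common_post [DecidableEq α] (h : N.IsCluster cl) {p q t : α}
    (hp : p ∈ cl) (hpp : p ∈ N.places) (hF : N.F p t) (hFq : N.F q t) : q ∈ cl :=
  h.mem_of_edge_transition (h.mem_of_place_edge hp hpp hF) (F_place_transition hpp hF) hFq

/-- In a free-choice net, every place of a cluster is a pre-place of every transition that
has a pre-place in the cluster. -/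
theorem IsCluster.edge_of_mem [DecidableEq α] (h : N.IsCluster cl) (hfc : N.FreeChoice)
    {p q t : α} (hp : p ∈ cl) (hpp : p ∈ N.places) (hF : N.F p t) (hq : q ∈ cl)
    (hqp : q ∈ N.places) : N.F q t := by
  obtain ⟨x, -, rfl⟩ := h
  have htt := F_place_transition hpp hF
  have hdisj : ∀ a ∈ N.places, a ∉ N.transitions := Finset.disjoint_left.mp N.disj
  let S : Set α := {y | (y ∈ N.places ∧ N.F y t) ∨ (y ∈ N.transitions ∧ N.F p y)}
  have hS : N.ClusterClosed S := by
    constructor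
    · rintro y (⟨-, hy⟩ | ⟨hy, -⟩) hyp u hu
      · exact Or.inr ⟨F_place_transition hyp hu, hfc y hyp t hy p hF u hu⟩
      · exact absurd hy (hdisj y hyp)
    · rintro y (⟨hy, -⟩ | ⟨-, hy⟩) hyt u hu
      · exact absurd hyt (hdisj y hy)
      · exact Or.inl ⟨place_of_F_transition hyt hu, hfc p hpp y hy u hu t hF⟩
  have hSc : N.ClusterClosed Sᶜ := by
    constructor
    · rintro y hyS hyp u hu (⟨hup, -⟩ | ⟨-, hu'⟩)
      · exact hdisj u hup (F_place_transition hyp hu)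
      · exact hyS (Or.inl ⟨hyp, hfc p hpp u hu' y hu t hF⟩)
    · rintro y hyS hyt u hu (⟨hup, hu'⟩ | ⟨hut, -⟩)
      · exact hyS (Or.inr ⟨hyt, hfc u hup t hu' p hF y hu⟩)
      · exact hdisj u (place_of_F_transition hyt hu) hut
  by_cases hx : x ∈ S
  · rcases hq S ⟨hx, hS⟩ with ⟨-, h'⟩ | ⟨h', -⟩
    · exact h'
    · exact absurd h' (hdisj q hqp)
  · exact absurd (Or.inl ⟨hpp, hF⟩) (hp Sᶜ ⟨hx, hSc⟩)

end Clusters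

section Pointing

variable {α : Type*} {N : Net α} {cl : Set α} {g : α → α}

/-- `N.PathTo cl n p`: some path leads from the place `p` into `cl` through `n` transitions. -/
inductive PathTo (N : Net α) (cl : Set α) : ℕ → α → Prop
  | zero {p : α} : p ∈ cl → PathTo N cl 0 p
  | succ {n : ℕ} {p t q : α} : N.F p t → N.F t q → PathTo N cl n q → PathTo N cl (n + 1) p

/-- An allocation pointing to `cl`: it selects, uniformly on clusters, a transition on a path
leading into `cl`. -/
structure Pointing (N : Net α) (cl : Set α) (g : α → α) : Prop where
  eq_of_common_post : ∀ p q t, p ∈ N.places → q ∈ N.places → N.F p t → N.F q t → g p = g q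
  edge : ∀ n p, N.PathTo cl n p → p ∉ cl → N.F p (g p)
  descent : ∀ n p, N.PathTo cl n p → p ∉ cl → ∃ q, N.F (g p) q ∧ ∃ m < n, N.PathTo cl m q

theorem FreeChoice.exists_pointing (hfc : N.FreeChoice) (cl : Set α) :
    ∃ g, N.Pointing cl g := by
  let W : Set α → ℕ → Prop := fun S n => ∃ t ∈ S, ∃ q, N.F t q ∧ N.PathTo cl n q
  rcases isEmpty_or_nonempty α with hα | hα
  · exact ⟨id, hα.elim, fun _ => hα.elim, fun _ => hα.elim⟩
  have hW : ∀ S : Set α, ∃ t : α, ∀ n, W S n →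
      t ∈ S ∧ ∃ q, N.F t q ∧ ∃ m ≤ n, N.PathTo cl m q := by
    intro S
    by_cases h : ∃ n, W S n
    · obtain ⟨t, htS, q, hq, hpq⟩ := Nat.find_spec h
      exact ⟨t, fun n hn => ⟨htS, q, hq, _, Nat.find_min' h hn, hpq⟩⟩
    · exact ⟨hα.some, fun n hn => absurd ⟨n, hn⟩ h⟩
  choose f hf using hW
  have key : ∀ n p, N.PathTo cl n p → p ∉ cl →
      N.F p (f (N.post p)) ∧ ∃ q, N.F (f (N.post p)) q ∧ ∃ m < n, N.PathTo cl m q := by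
    intro n p hp hpc
    cases hp with
    | zero h => exact absurd h hpc
    | @succ n _ t q h1 h2 h3 =>
      obtain ⟨h4, q', h6, m, hm, h7⟩ := hf (N.post p) n ⟨t, h1, q, h2, h3⟩
      exact ⟨h4, q', h6, m, Nat.lt_succ_of_le hm, h7⟩
  refine ⟨fun p => f (N.post p), ?_, fun n p h h' => (key n p h h').1,
    fun n p h h' => (key n p h h').2⟩
  intro p q t hp hq h1 h2
  have : N.post p = N.post q := by
    ext u
    exact ⟨fun hu => hfc p hp t h1 q h2 u hu, fun hu => hfc q hq t h2 p h1 u hu⟩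
  simp only [this]

/-- The transitions selected by the allocation `g` outside `cl`. -/
def Allocated (N : Net α) (cl : Set α) (g : α → α) (t : α) : Prop :=
  ∃ p ∈ N.places, N.F p t ∧ p ∉ cl ∧ (∃ n, N.PathTo cl n p) ∧ t = g p

theorem Allocated.mem_transitions {t : α} (h : N.Allocated cl g t) : t ∈ N.transitions := by
  obtain ⟨p, hp, hF, -⟩ := h
  exact F_place_transition hp hF

theorem Allocated.eq (hg : N.Pointing cl g) {t q : α} (h : N.Allocated cl g t) (hq : N.F q t) :
    t = g q := by
  have ht := h.mem_transitions
  obtain ⟨p, hp, hF, -, -, h'⟩ := h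
  exact h'.trans (hg.eq_of_common_post p q t hp (place_of_F_transition ht hq) hF hq)

theorem Allocated.pathTo (hg : N.Pointing cl g) {t q : α} (h : N.Allocated cl g t)
    (hq : N.F q t) : ∃ n, N.PathTo cl n q := by
  obtain ⟨p, hp, hF, hpc, ⟨n, hn⟩, rfl⟩ := h
  obtain ⟨r, hr, m, -, hm⟩ := hg.descent n p hn hpc
  exact ⟨m + 1, PathTo.succ hq hr hm⟩

theorem Allocated.notMem [DecidableEq α] (hcl : N.IsCluster cl) {t q : α}
    (h : N.Allocated cl g t) (hq : N.F q t) : q ∉ cl := by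
  have ht := h.mem_transitions
  obtain ⟨p, hp, hF, hpc, -⟩ := h
  exact fun hqc => hpc (hcl.mem_of_common_post hqc (place_of_F_transition ht hq) hq hF)

/-- All pre-places of a transition have a path to the cluster if one of them does. -/
theorem PathTo.of_common_post [DecidableEq α] (hcl : N.IsCluster cl) (hfc : N.FreeChoice)
    {p q t : α} (hp : p ∈ N.places) (hF : N.F p t) (hF' : N.F q t)
    (h : ∃ n, N.PathTo cl n p) : ∃ n, N.PathTo cl n q := by
  obtain ⟨n, hn⟩ := h
  cases hn with
  | zero h => exact ⟨0, PathTo.zero (hcl.mem_of_common_post h hp hF hF')⟩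
  | @succ n _ u r h1 h2 h3 => exact ⟨n + 1, PathTo.succ (hfc p hp t hF q hF' u h1) h2 h3⟩

theorem Pointing.allocated (hg : N.Pointing cl g) {p : α} (hp : p ∈ N.places) (hpc : p ∉ cl)
    (h : ∃ n, N.PathTo cl n p) : N.Allocated cl g (g p) := by
  obtain ⟨n, hn⟩ := h
  exact ⟨p, hp, hg.edge n p hn hpc, hpc, ⟨n, hn⟩, rfl⟩

theorem count_le_countP_pre [DecidableEq α] {v p : α} (h : N.F v p) (σ : List α) :
    σ.count v ≤ σ.countP (fun t => decide (N.F t p)) := by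
  rw [List.count]
  refine List.countP_mono_left fun x _ hx => ?_
  have : x = v := by simpa using hx
  simpa [this] using h

theorem Pointing.countP_post_le [DecidableEq α] (hg : N.Pointing cl g) {σ : List α}
    (hσ : ∀ t ∈ σ, N.Allocated cl g t) (p : α) :
    σ.countP (fun t => decide (N.F p t)) ≤ σ.count (g p) := by
  rw [List.count]
  refine List.countP_mono_left fun x hx h => ?_
  have h : N.F p x := by simpa using h
  simpa using (hσ x hx).eq hg h

theorem countP_post_eq_zero {σ : List α} {p : α} (hσ : ∀ t ∈ σ, N.Allocated cl g t)
    (hp : ∀ t, N.Allocated cl g t → ¬ N.F p t) :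
    σ.countP (fun t => decide (N.F p t)) = 0 := by
  rw [List.countP_eq_zero]
  intro t ht
  simpa using hp t (hσ t ht)

/-- Runs inside a pointing allocation terminate: each selected transition occurs boundedly
often. -/
theorem Pointing.exists_count_le [DecidableEq α] (hg : N.Pointing cl g) (hcl : N.IsCluster cl)
    {μ₀ μ : α → ℕ} (hb : N.Bounded μ₀) (hμ : N.Reach μ₀ μ) (n : ℕ) :
    ∀ p ∈ N.places, N.PathTo cl n p → p ∉ cl → ∃ B, ∀ σ ν, N.FireSeq μ σ ν →
      (∀ t ∈ σ, N.Allocated cl g t) → σ.count (g p) ≤ B := by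
  obtain ⟨K, hK⟩ := hb
  induction n using Nat.strong_induction_on with
  | _ n ih =>
    intro p hp hpn hpc
    obtain ⟨q, hq, m, hm, hqm⟩ := hg.descent n p hpn hpc
    have hqp : q ∈ N.places :=
      F_transition_place (F_place_transition hp (hg.edge n p hpn hpc)) hq
    by_cases hqc : q ∈ cl
    · refine ⟨K, fun σ ν hσ hA => ?_⟩
      have h1 := hσ.balance q
      have h2 := count_le_countP_pre hq σ
      have h3 := countP_post_eq_zero hA fun t ht hF => ht.notMem hcl hF hqc
      have h4 := hK ν (hμ.trans ⟨σ, hσ⟩) q hqp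
      omega
    · obtain ⟨B, hB⟩ := ih m hm q hqp hqm hqc
      refine ⟨K + B, fun σ ν hσ hA => ?_⟩
      have h1 := hσ.balance q
      have h2 := count_le_countP_pre hq σ
      have h3 := hg.countP_post_le hA q
      have h4 := hK ν (hμ.trans ⟨σ, hσ⟩) q hqp
      have h5 := hB σ ν hσ hA
      omega

theorem Pointing.exists_run [DecidableEq α] (hg : N.Pointing cl g) (hcl : N.IsCluster cl)
    {μ₀ μ : α → ℕ} (hb : N.Bounded μ₀) (hμ : N.Reach μ₀ μ) :
    ∃ σ ν, N.FireSeq μ σ ν ∧ (∀ t ∈ σ, N.Allocated cl g t) ∧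
      ∀ t, N.Allocated cl g t → ¬ N.Enabled ν t := by
  by_contra! hcon
  have hlong : ∀ n : ℕ, ∃ σ ν, N.FireSeq μ σ ν ∧ (∀ t ∈ σ, N.Allocated cl g t) ∧
      σ.length = n := by
    intro n
    induction n with
    | zero => exact ⟨[], μ, FireSeq.nil μ, by simp, rfl⟩
    | succ n ih =>
      obtain ⟨σ, ν, h1, h2, h3⟩ := ih
      obtain ⟨t, ht, he⟩ := hcon σ ν h1 h2
      refine ⟨σ ++ [t], N.fire t ν, h1.append (FireSeq.cons he (FireSeq.nil _)), ?_, by simp [h3]⟩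
      intro u hu
      rcases List.mem_append.mp hu with hu | hu
      · exact h2 u hu
      · rw [List.mem_singleton.mp hu]
        exact ht
  have hbd : ∀ t, ∃ B, ∀ σ ν, N.FireSeq μ σ ν → (∀ t ∈ σ, N.Allocated cl g t) →
      σ.count t ≤ B := by
    intro t
    by_cases ht : N.Allocated cl g t
    · obtain ⟨p, hp, -, hpc, ⟨n, hn⟩, rfl⟩ := ht
      exact hg.exists_count_le hcl hb hμ n p hp hn hpc
    · refine ⟨0, fun σ ν _ hA => ?_⟩
      rw [List.count_eq_zero.mpr fun h => ht (hA t h)]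
  choose B hB using hbd
  obtain ⟨σ, ν, h1, h2, h3⟩ := hlong ((∑ t ∈ N.transitions, B t) + 1)
  have h4 : ∑ t ∈ N.transitions, σ.count t = σ.length := by
    simpa using Multiset.sum_count_eq_card (s := N.transitions) (m := (σ : Multiset α))
      (by simpa using h1.mem_transitions)
  have h5 : ∑ t ∈ N.transitions, σ.count t ≤ ∑ t ∈ N.transitions, B t :=
    Finset.sum_le_sum fun t _ => hB t σ ν h1 h2
  omega

/-- If only transitions of the cluster, or transitions without a path to it, are enabled, and the
cluster can be fully marked, then it is already fully marked. -/
theorem FireSeq.one_le_of_blocked [DecidableEq α] (hfc : N.FreeChoice) (hcl : N.IsCluster cl)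
    (hsource : ∀ t ∈ N.transitions, (∀ p, ¬ N.F p t) → ∀ q, ¬ N.F t q)
    {μ ν : α → ℕ} {σ : List α} (h : N.FireSeq μ σ ν)
    (hν : ∀ p ∈ N.places, p ∈ cl → 1 ≤ ν p)
    (hμ : ∀ t, N.Enabled μ t → ∀ p ∈ N.places, N.F p t → (∃ n, N.PathTo cl n p) → p ∈ cl) :
    ∀ p ∈ N.places, p ∈ cl → 1 ≤ μ p := by
  induction h with
  | nil => exact hν
  | @cons μ ν t σ he _ ih =>
    intro p hp hpc
    by_cases hgood : ∃ q ∈ N.places, N.F q t ∧ ∃ n, N.PathTo cl n q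
    · obtain ⟨q, hq, hF, hn⟩ := hgood
      exact he.2 p (hcl.edge_of_mem hfc (hμ t he q hq hF hn) hq hF hpc hp)
    · push Not at hgood
      have hout : ∀ q, (∃ n, N.PathTo cl n q) → ¬ N.F t q := by
        rintro q ⟨n, hn⟩ hq
        by_cases hpre : ∀ r, ¬ N.F r t
        · exact hsource t he.1 hpre q hq
        · push Not at hpre
          obtain ⟨r, hr⟩ := hpre
          exact hgood r (place_of_F_transition he.1 hr) hr (n + 1) (PathTo.succ hr hq hn)
      have hle : ∀ q, (∃ n, N.PathTo cl n q) → N.fire t μ q ≤ μ q := by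
        intro q hq
        have := fire_add he q
        rw [if_neg (hout q hq)] at this
        omega
      refine (ih hν ?_ p hp hpc).trans (hle p ⟨0, PathTo.zero hpc⟩)
      intro u hu q hq hF hn
      refine hμ u ⟨hu.1, fun r hr => ?_⟩ q hq hF hn
      exact (hu.2 r hr).trans (hle r (PathTo.of_common_post hcl hfc hq hF hr hn))

theorem Pointing.mem_of_blocked (hg : N.Pointing cl g) (hfc : N.FreeChoice) {ν : α → ℕ}
    (hν : ∀ t, N.Allocated cl g t → ¬ N.Enabled ν t) :
    ∀ t, N.Enabled ν t → ∀ p ∈ N.places, N.F p t → (∃ n, N.PathTo cl n p) → p ∈ cl := by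
  intro t he p hp hF hn
  by_contra hpc
  have hA := hg.allocated hp hpc hn
  obtain ⟨n, hn⟩ := hn
  refine hν (g p) hA ⟨hA.mem_transitions, fun r hr => he.2 r ?_⟩
  exact hfc p hp (g p) (hg.edge n p hn hpc) r hr t hF

/-- The flow relation between allocated transitions. -/
def AllocFlow (N : Net α) (cl : Set α) (g : α → α) (v u : α) : Prop :=
  N.Allocated cl g v ∧ N.Allocated cl g u ∧ ∃ p, N.F v p ∧ N.F p u

end Pointing

section Home

variable {α : Type*} [DecidableEq α] {N : Net α} {cl : Set α} {g : α → α} {μ₀ μh : α → ℕ}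

/-- `μh` marks the cluster `cl` once and can be reached from every reachable marking. -/
structure ClusterHome (N : Net α) (μ₀ μh : α → ℕ) (cl : Set α) : Prop where
  one_of_mem : ∀ p ∈ N.places, p ∈ cl → μh p = 1
  zero_of_notMem : ∀ p ∈ N.places, p ∉ cl → μh p = 0
  reach : ∀ μ, N.Reach μ₀ μ → N.Reach μ μh

theorem Perpetual.exists_clusterHome (h : N.Perpetual μ₀ cl) :
    ∃ μh, N.ClusterHome μ₀ μh cl := by
  obtain ⟨-, -, -, hhome⟩ := h
  refine ⟨fun p => if p ∈ N.places then N.clusterMarking cl p else μ₀ p, ?_, ?_, ?_⟩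
  · intro p hp hpc
    simp [clusterMarking, hp, hpc]
  · intro p hp hpc
    simp [clusterMarking, hp, hpc]
  · intro μ hμ
    obtain ⟨ν, hν, heq⟩ := hhome μ hμ
    convert hν using 1
    funext p
    by_cases hp : p ∈ N.places
    · simp [hp, heq p hp]
    · obtain ⟨σ, hσ⟩ := hμ.trans hν
      simp [hp, hσ.eq_of_notMem_places hp]

/-- From a marking reachable from the home marking, the allocation leads back to it. -/
theorem ClusterHome.exists_run_of_reach (hh : N.ClusterHome μ₀ μh cl) (hb : N.Bounded μ₀)
    (hfc : N.FreeChoice) (hcl : N.IsCluster cl) (hg : N.Pointing cl g) {μ : α → ℕ}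
    (hμ : N.Reach μh μ) : ∃ σ, N.FireSeq μ σ μh ∧ ∀ t ∈ σ, N.Allocated cl g t := by
  have hμh := hh.reach μ₀ (Reach.refl _)
  obtain ⟨σ, ν, hσ, hA, hν⟩ := hg.exists_run hcl hb (hμh.trans hμ)
  have hμν : N.Reach μh ν := hμ.trans ⟨σ, hσ⟩
  obtain ⟨ρ, hρ⟩ := hh.reach ν (hμh.trans hμν)
  have hone := hρ.one_le_of_blocked hfc hcl
    (fun t ht hpre => hb.post_eq_empty_of_pre_eq_empty hμh ht hpre)
    (fun p hp hpc => (hh.one_of_mem p hp hpc).ge) (hg.mem_of_blocked hfc hν)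
  have : ν = μh := hb.eq_of_reach_of_le hμh hμν fun p => by
    by_cases hp : p ∈ N.places
    · by_cases hpc : p ∈ cl
      · exact (hh.one_of_mem p hp hpc).trans_le (hone p hp hpc)
      · simp [hh.zero_of_notMem p hp hpc]
    · exact (hρ.eq_of_notMem_places hp).le
  exact ⟨σ, this ▸ hσ, hA⟩

theorem ClusterHome.add_count_le (hh : N.ClusterHome μ₀ μh cl) (hcl : N.IsCluster cl)
    (hg : N.Pointing cl g) {μ : α → ℕ} {σ : List α} (hσ : N.FireSeq μ σ μh)
    (hA : ∀ t ∈ σ, N.Allocated cl g t) {u v p : α} (hu : N.Allocated cl g u) (hv : N.F v p)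
    (hp : N.F p u) : μ p + σ.count v ≤ σ.count u := by
  have h1 := hσ.balance p
  have h2 := count_le_countP_pre hv σ
  have h3 := hg.countP_post_le hA p
  rw [← hu.eq hg hp] at h3
  have h4 := hh.zero_of_notMem p (place_of_F_transition hu.mem_transitions hp)
    (hu.notMem hcl hp)
  omega

/-- The flow between allocated transitions is acyclic. -/
theorem ClusterHome.not_transGen_self (hh : N.ClusterHome μ₀ μh cl) (hl : N.Live μ₀)
    (hb : N.Bounded μ₀) (hfc : N.FreeChoice) (hcl : N.IsCluster cl) (hg : N.Pointing cl g)
    (u : α) : ¬ Relation.TransGen (N.AllocFlow cl g) u u := by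
  intro h
  obtain ⟨v, huv, hvA, huA, p, hvp, hpu⟩ := Relation.TransGen.tail'_iff.mp h
  obtain ⟨μ, hμ, he⟩ := hl u huA.mem_transitions μh (hh.reach μ₀ (Reach.refl _))
  obtain ⟨σ, hσ, hA⟩ := hh.exists_run_of_reach hb hfc hcl hg hμ
  have hmono : σ.count u ≤ σ.count v := by
    clear hvA hvp h
    induction huv with
    | refl => exact le_rfl
    | tail _ hbc ih =>
      obtain ⟨-, hc, q, hq, hq'⟩ := hbc
      have := hh.add_count_le hcl hg hσ hA hc hq hq'
      omega
  have h1 := hh.add_count_le hcl hg hσ hA huA hvp hpu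
  have h2 := he.2 p hpu
  omega

/-- The effect of each transition is an integer combination of effects of allocated
transitions. -/
theorem ClusterHome.effect_mem_span (hh : N.ClusterHome μ₀ μh cl) (hl : N.Live μ₀)
    (hb : N.Bounded μ₀) (hfc : N.FreeChoice) (hcl : N.IsCluster cl) (hg : N.Pointing cl g)
    {t : α} (ht : t ∈ N.transitions) :
    N.effect t ∈ Submodule.span ℤ (N.effect '' {u | N.Allocated cl g u}) := by
  have hsub : ∀ μ, N.Reach μh μ →
      toInt μh - toInt μ ∈ Submodule.span ℤ (N.effect '' {u | N.Allocated cl g u}) := by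
    intro μ hμ
    obtain ⟨σ, hσ, hA⟩ := hh.exists_run_of_reach hb hfc hcl hg hμ
    exact hσ.toInt_sub_mem fun u hu => Submodule.subset_span ⟨u, hA u hu, rfl⟩
  obtain ⟨μ, hμ, he⟩ := hl t ht μh (hh.reach μ₀ (Reach.refl _))
  have h1 := hsub μ hμ
  have h2 := hsub _ (hμ.trans (Reach.fire he))
  rw [toInt_fire he] at h2
  convert Submodule.sub_mem _ h1 h2 using 1
  abel

/-- From every reachable marking, the allocation leads to the home marking. -/
theorem ClusterHome.exists_run (hh : N.ClusterHome μ₀ μh cl) (hl : N.Live μ₀)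
    (hb : N.Bounded μ₀) (hfc : N.FreeChoice) (hcl : N.IsCluster cl) (hg : N.Pointing cl g)
    {μ : α → ℕ} (hμ : N.Reach μ₀ μ) :
    ∃ σ, N.FireSeq μ σ μh ∧ ∀ t ∈ σ, N.Allocated cl g t := by
  obtain ⟨σ, ν, hσ, hA, hν⟩ := hg.exists_run hcl hb hμ
  suffices h : μh = ν from ⟨σ, h ▸ hσ, hA⟩
  obtain ⟨ρ, hρ⟩ := hh.reach ν (hμ.trans ⟨σ, hσ⟩)
  have hmem := hρ.toInt_sub_mem fun t ht =>
    hh.effect_mem_span hl hb hfc hcl hg (hρ.mem_transitions t ht)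
  let TA : Finset α := N.transitions.filter (N.Allocated cl g)
  have hTA : {u | N.Allocated cl g u} = (TA : Set α) := by
    ext u
    simpa [TA] using fun h : N.Allocated cl g u => h.mem_transitions
  rw [hTA, Submodule.mem_span_image_finset_iff_exists_fun'] at hmem
  obtain ⟨z, hz⟩ := hmem
  have hz' : ∀ p, ∑ t ∈ TA, z t * N.effect t p = (μh p : ℤ) - ν p := by
    intro p
    have := congrFun hz p
    simpa [toInt, Finset.sum_apply] using this
  suffices hzero : ∀ t ∈ TA, z t = 0 by
    funext p
    have h1 := hz' p
    rw [Finset.sum_eq_zero fun t ht => by rw [hzero t ht, zero_mul]] at h1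
    omega
  by_contra! hne
  let Z : Finset α := TA.filter fun t => z t ≠ 0
  have hZ : (Z : Set α).Nonempty := by
    obtain ⟨t, ht, htz⟩ := hne
    exact ⟨t, by simp [Z, ht, htz]⟩
  have : Std.Irrefl (Relation.TransGen (N.AllocFlow cl g)) :=
    ⟨hh.not_transGen_self hl hb hfc hcl hg⟩
  have : IsStrictOrder α (Relation.TransGen (N.AllocFlow cl g)) := {}
  obtain ⟨u, huZ, humin⟩ := (Set.wellFoundedOn_iff.mp
    (Z.wellFoundedOn (r := Relation.TransGen (N.AllocFlow cl g)))).has_min _ hZ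
  obtain ⟨huT, huz⟩ := Finset.mem_filter.mp huZ
  have huA : N.Allocated cl g u := (Finset.mem_filter.mp huT).2
  have hmin : ∀ t ∈ TA, z t ≠ 0 → ∀ p, N.F p u → ¬ N.F t p := fun t ht htz p hp hF =>
    humin t (Finset.mem_filter.mpr ⟨ht, htz⟩)
      ⟨.single ⟨(Finset.mem_filter.mp ht).2, huA, p, hF, hp⟩, Finset.mem_filter.mpr ⟨ht, htz⟩,
        huZ⟩
  have hval : ∀ p, N.F p u → (ν p : ℤ) = z u := by
    intro p hp
    have h1 := hz' p
    rw [Finset.sum_eq_single_of_mem u huT] at h1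
    · have h2 := hh.zero_of_notMem p (place_of_F_transition huA.mem_transitions hp)
        (huA.notMem hcl hp)
      simp only [effect, hp, hmin u huT huz p hp, h2, if_true, if_false] at h1
      push_cast at h1
      linarith
    · intro t ht htu
      by_cases htz : z t = 0
      · simp [htz]
      · have h2 : ¬ N.F p t := fun h =>
          htu (((Finset.mem_filter.mp ht).2.eq hg h).trans (huA.eq hg hp).symm)
        simp [effect, h2, hmin t ht htz p hp]
  refine hν u huA ⟨huA.mem_transitions, fun p hp => ?_⟩
  have := hval p hp
  omega

theorem ClusterHome.le_one (hh : N.ClusterHome μ₀ μh cl) (hl : N.Live μ₀)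
    (hb : N.Bounded μ₀) (hfc : N.FreeChoice) (hcl : N.IsCluster cl)
    {μ : α → ℕ} (hμ : N.Reach μ₀ μ) {p : α} (hp : p ∈ N.places) : μ p ≤ 1 := by
  obtain ⟨g, hg⟩ := hfc.exists_pointing cl
  obtain ⟨σ, hσ, hA⟩ := hh.exists_run hl hb hfc hcl hg hμ
  have hcount : ∀ n, ∀ p ∈ N.places, N.PathTo cl n p → p ∉ cl → σ.count (g p) ≤ 1 := by
    intro n
    induction n using Nat.strong_induction_on with
    | _ n ih =>
      intro p hp hpn hpc
      obtain ⟨q, hq, m, hm, hqm⟩ := hg.descent n p hpn hpc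
      have hqp : q ∈ N.places :=
        F_transition_place (F_place_transition hp (hg.edge n p hpn hpc)) hq
      have h1 := hσ.balance q
      have h2 := count_le_countP_pre hq σ
      by_cases hqc : q ∈ cl
      · have h3 := countP_post_eq_zero hA fun t ht hF => ht.notMem hcl hF hqc
        have h4 := hh.one_of_mem q hqp hqc
        omega
      · have h3 := hg.countP_post_le hA q
        have h4 := hh.zero_of_notMem q hqp hqc
        have h5 := ih m hm q hqp hqm hqc
        omega
  have h1 := hσ.balance p
  by_cases hpc : p ∈ cl
  · have h3 := countP_post_eq_zero hA fun t ht hF => ht.notMem hcl hF hpc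
    have h4 := hh.one_of_mem p hp hpc
    omega
  · have h4 := hh.zero_of_notMem p hp hpc
    by_cases hgood : ∃ n, N.PathTo cl n p
    · obtain ⟨n, hn⟩ := hgood
      have h3 := hg.countP_post_le hA p
      have h5 := hcount n p hp hn hpc
      omega
    · have h3 := countP_post_eq_zero hA fun t ht hF => hgood (ht.pathTo hg hF)
      omega

end Home

end Net

/-- **Perpetual free-choice systems are safe.** If `(N, μ₀)` is a perpetual
free-choice system, then every reachable marking takes values in `{0, 1}`. -/
theorem perpetual_freeChoice_safe
    {α : Type*} [DecidableEq α] (N : Net α) (μ₀ : α → ℕ) (cl : Set α)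
    (hfc : N.FreeChoice) (hperp : N.Perpetual μ₀ cl) :
    ∀ μ, N.Reach μ₀ μ → ∀ p ∈ N.places, μ p ≤ 1 := by
  obtain ⟨μh, hh⟩ := hperp.exists_clusterHome
  intro μ hμ p hp
  exact hh.le_one hperp.1 hperp.2.1 hfc hperp.2.2.1 hμ hp
end

section
/- Circuits of perpetual T-systems: let (TN,μ₀) be a perpetual T-system with regeneration cluster cl, and let t_cl be the unique transition of cl. Then every elementary circuit γ of TN contains t_cl, and the token count ‖μ‖_γ equals 1 for every reachable marking μ of (TN,μ₀). -/
open Classical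

namespace Net

variable {α : Type*} {N : Net α}

theorem not_mem_transitions_of_mem_places {x : α} (hx : x ∈ N.places) : x ∉ N.transitions :=
  fun h => Finset.disjoint_left.mp N.disj hx h

theorem F.mem_transitions {p t : α} (h : N.F p t) (hp : p ∈ N.places) : t ∈ N.transitions := by
  rcases N.edges p t h with h' | h'
  · exact h'.2
  · exact absurd h'.1 (not_mem_transitions_of_mem_places hp)

theorem F.mem_places {t p : α} (h : N.F t p) (ht : t ∈ N.transitions) : p ∈ N.places := by
  rcases N.edges t p h with h' | h'
  · exact absurd ht (not_mem_transitions_of_mem_places h'.1)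
  · exact h'.2

theorem F.mem_places_left {p t : α} (h : N.F p t) (ht : t ∈ N.transitions) : p ∈ N.places := by
  rcases N.edges p t h with h' | h'
  · exact h'.1
  · exact absurd ht (not_mem_transitions_of_mem_places h'.2)

theorem F.mem_transitions_left {t p : α} (h : N.F t p) (hp : p ∈ N.places) :
    t ∈ N.transitions := by
  rcases N.edges t p h with h' | h'
  · exact absurd h'.2 (not_mem_transitions_of_mem_places hp)
  · exact h'.1

variable [DecidableEq α]

theorem tokenCount_congr {μ ν : α → ℕ} (h : N.MarkingEq μ ν) (X : Finset α) :
    N.tokenCount μ X = N.tokenCount ν X :=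
  Finset.sum_congr rfl fun p hp => h p (Finset.mem_inter.mp hp).2

/-- In a T-net, the places of a cluster are exactly the pre-places of its transition. -/
theorem IsTNet.F_of_mem_cluster (hT : N.IsTNet) {cl : Set α} (hcl : N.IsCluster cl) {t : α}
    (ht : t ∈ cl) (htN : t ∈ N.transitions) {p : α} (hp : p ∈ cl) (hpN : p ∈ N.places) :
    N.F p t := by
  obtain ⟨x, hx, rfl⟩ := hcl
  obtain ⟨s, hs, hxs⟩ : ∃ s ∈ N.transitions, x = s ∨ N.F x s := by
    rcases Finset.mem_union.mp hx with hx | hx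
    · obtain ⟨s, hs, -⟩ := (hT x hx).2
      exact ⟨s, hs.mem_transitions hx, .inr hs⟩
    · exact ⟨x, hx, .inl rfl⟩
  have hsub : ∀ y ∈ N.clusterOf x, y = s ∨ N.F y s := by
    intro y hy
    refine hy {y | y = s ∨ N.F y s} ⟨hxs, ?_, ?_⟩
    · rintro q (rfl | hq) hqN u hu
      · exact absurd hs (not_mem_transitions_of_mem_places hqN)
      · exact .inl ((hT q hqN).2.unique hu hq)
    · rintro u (rfl | hu) huN q hq
      · exact .inr hq
      · exact absurd huN (not_mem_transitions_of_mem_places (hu.mem_places_left hs))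
  have hts : t = s := by
    rcases hsub t ht with h | h
    · exact h
    · exact absurd htN (not_mem_transitions_of_mem_places (h.mem_places_left hs))
  subst hts
  rcases hsub p hp with rfl | h
  · exact absurd htN (not_mem_transitions_of_mem_places hpN)
  · exact h

/-- The cyclic successor along an elementary circuit follows the edges of the net. -/
theorem IsCircuit.F_formPerm {γ : List α} (hγ : N.IsCircuit γ) (hnd : γ.Nodup) {x : α}
    (hx : x ∈ γ) : N.F x (γ.formPerm x) := by
  obtain ⟨⟨-, -, hchain⟩, _, hclose⟩ := hγ
  obtain ⟨i, hi, rfl⟩ := List.getElem_of_mem hx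
  rw [List.formPerm_apply_getElem _ hnd]
  by_cases hlast : i + 1 < γ.length
  · simp only [Nat.mod_eq_of_lt hlast]
    exact List.isChain_iff_getElem.mp hchain i hlast
  · obtain rfl : i = γ.length - 1 := by omega
    have hmod : (γ.length - 1 + 1) % γ.length = 0 := by
      rw [Nat.sub_add_cancel (by omega), Nat.mod_self]
    simpa only [hmod, List.getLast_eq_getElem, List.head_eq_getElem] using hclose

/-- Each transition takes as many tokens from an elementary circuit of a T-net as it puts on it. -/
theorem IsCircuit.sum_pre_eq_sum_post (hT : N.IsTNet) {γ : List α} (hγ : N.IsCircuit γ)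
    (hnd : γ.Nodup) (t : α) :
    ∑ p ∈ γ.toFinset ∩ N.places, (if N.F p t then 1 else 0) =
      ∑ p ∈ γ.toFinset ∩ N.places, (if N.F t p then 1 else 0) := by
  have hmem : ∀ x, γ.formPerm x ∈ γ ↔ x ∈ γ := fun x => List.formPerm_mem_iff_mem
  refine Finset.sum_equiv (γ.formPerm.trans γ.formPerm) (fun p => ?_) fun p hp => ?_
  · simp only [Finset.mem_inter, List.mem_toFinset, Equiv.trans_apply, hmem]
    refine and_congr_right fun hp => ?_
    have h₁ := hγ.F_formPerm hnd hp
    have h₂ := hγ.F_formPerm hnd ((hmem p).mpr hp)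
    exact ⟨fun h => h₂.mem_places (h₁.mem_transitions h),
      fun h => h₁.mem_places_left (h₂.mem_transitions_left h)⟩
  · simp only [Finset.mem_inter, List.mem_toFinset] at hp
    have h₁ := hγ.F_formPerm hnd hp.1
    have h₂ := hγ.F_formPerm hnd ((hmem p).mpr hp.1)
    have hq := h₂.mem_places (h₁.mem_transitions hp.2)
    refine if_congr ⟨fun h => ?_, fun h => ?_⟩ rfl rfl
    · rwa [(hT p hp.2).2.unique h h₁]
    · rwa [(hT _ hq).1.unique h h₂]

theorem IsCircuit.tokenCount_fire (hT : N.IsTNet) {γ : List α} (hγ : N.IsCircuit γ)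
    (hnd : γ.Nodup) {μ : α → ℕ} {t : α} (ht : N.Enabled μ t) :
    N.tokenCount (N.fire t μ) γ.toFinset = N.tokenCount μ γ.toFinset := by
  have hadd : N.tokenCount (N.fire t μ) γ.toFinset +
        ∑ p ∈ γ.toFinset ∩ N.places, (if N.F p t then 1 else 0) =
      N.tokenCount μ γ.toFinset +
        ∑ p ∈ γ.toFinset ∩ N.places, (if N.F t p then 1 else 0) := by
    simp only [tokenCount, ← Finset.sum_add_distrib]
    refine Finset.sum_congr rfl fun p _ => ?_
    have hle : (if N.F p t then 1 else 0) ≤ μ p := by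
      split_ifs with h
      · exact ht.2 p h
      · exact Nat.zero_le _
    simp only [fire]
    omega
  rw [hγ.sum_pre_eq_sum_post hT hnd t] at hadd
  exact Nat.add_right_cancel hadd

/-- The token count of an elementary circuit of a T-net is invariant under firing. -/
theorem IsCircuit.tokenCount_eq_of_reach (hT : N.IsTNet) {γ : List α} (hγ : N.IsCircuit γ)
    (hnd : γ.Nodup) {μ ν : α → ℕ} (h : N.Reach μ ν) :
    N.tokenCount ν γ.toFinset = N.tokenCount μ γ.toFinset := by
  obtain ⟨σ, hσ⟩ := h
  induction hσ with
  | nil => rfl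
  | cons he _ ih => rw [ih, hγ.tokenCount_fire hT hnd he]

/-- A circuit contains a place followed by a transition. -/
theorem IsCircuit.exists_place {γ : List α} (hγ : N.IsCircuit γ) (hnd : γ.Nodup) :
    ∃ p ∈ γ, p ∈ N.places ∧ γ.formPerm p ∈ N.transitions := by
  obtain ⟨x, hx⟩ := List.exists_mem_of_ne_nil γ hγ.1.1
  have hx' : γ.formPerm x ∈ γ := List.formPerm_mem_iff_mem.mpr hx
  rcases N.edges _ _ (hγ.F_formPerm hnd hx) with h | h
  · exact ⟨x, hx, h⟩
  · exact ⟨_, hx', h.2, (hγ.F_formPerm hnd hx').mem_transitions h.2⟩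

theorem Live.tokenCount_pos (hT : N.IsTNet) {μ₀ : α → ℕ} (hlive : N.Live μ₀) {γ : List α}
    (hγ : N.IsCircuit γ) (hnd : γ.Nodup) : 0 < N.tokenCount μ₀ γ.toFinset := by
  obtain ⟨p, hp, hpN, ht⟩ := hγ.exists_place hnd
  obtain ⟨ν, hν, -, hen⟩ := hlive _ ht μ₀ (.refl μ₀)
  rw [← hγ.tokenCount_eq_of_reach hT hnd hν]
  exact Finset.sum_pos_iff.mpr
    ⟨p, by simp [hp, hpN], hen p (hγ.F_formPerm hnd hp)⟩

end Net

/-- **Circuits of perpetual T-systems.** Let `(TN, μ₀)` be a perpetual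
T-system with regeneration cluster `cl` and unique transition `t_cl ∈ cl`.
Then every elementary circuit `γ` of `TN` contains `t_cl` and has token count
`‖μ‖_γ = 1` at every reachable marking `μ`. -/
theorem circuit_of_perpetual_tSystem
    {α : Type*} [DecidableEq α] (TN : Net α) (μ₀ : α → ℕ)
    (hT : TN.IsTNet) (cl : Set α) (hperp : TN.Perpetual μ₀ cl)
    (tcl : α) (htcl : tcl ∈ cl ∧ tcl ∈ TN.transitions)
    (γ : List α) (hγ : TN.IsCircuit γ) (helem : γ.Nodup) :
    tcl ∈ γ ∧ ∀ μ, TN.Reach μ₀ μ → TN.tokenCount μ γ.toFinset = 1 := by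
  obtain ⟨hlive, -, hcl, hhome⟩ := hperp
  obtain ⟨ν, hν, hνcl⟩ := hhome μ₀ (.refl μ₀)
  have hsucc : ∀ p ∈ γ, p ∈ TN.places → p ∈ cl → γ.formPerm p = tcl := fun p hp hpN hpcl =>
    (hT p hpN).2.unique (hγ.F_formPerm helem hp)
      (hT.F_of_mem_cluster hcl htcl.1 htcl.2 hpcl hpN)
  have hcount : TN.tokenCount μ₀ γ.toFinset =
      ((γ.toFinset ∩ TN.places).filter (· ∈ cl)).card := by
    rw [← hγ.tokenCount_eq_of_reach hT helem hν, Net.tokenCount_congr hνcl, Finset.card_filter]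
    refine Finset.sum_congr rfl fun p hp => ?_
    simp [Net.clusterMarking, (Finset.mem_inter.mp hp).2]
  have hpos := hlive.tokenCount_pos hT hγ helem
  refine ⟨?_, fun μ hμ => ?_⟩
  · rw [hcount, Finset.card_pos] at hpos
    obtain ⟨p, hp⟩ := hpos
    simp only [Finset.mem_filter, Finset.mem_inter, List.mem_toFinset] at hp
    rw [← hsucc p hp.1.1 hp.1.2 hp.2]
    exact List.formPerm_mem_iff_mem.mpr hp.1.1
  · rw [hγ.tokenCount_eq_of_reach hT helem hμ]
    refine le_antisymm ?_ hpos
    rw [hcount, Finset.card_le_one]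
    intro p hp q hq
    simp only [Finset.mem_filter, Finset.mem_inter, List.mem_toFinset] at hp hq
    exact γ.formPerm.injective
      ((hsucc p hp.1.1 hp.1.2 hp.2).trans (hsucc q hq.1.1 hq.1.2 hq.2).symm)
end
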